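/- Let p ∈ [2, ∞) and let (X, ‖·‖_X) be a Banach space. Assume: (i) X is an X_p Banach space, i.e. there is K₁ ∈ (0, ∞) such that for all n ∈ ℕ, k ∈ [n] and v₁, …, v_n ∈ X, (1/(2^n binom(n,k))) Σ_{S⊆[n],|S|=k} Σ_{ε∈{−1,1}^n} ‖Σ_{j∈S} ε_j v_j‖_X^p ≤ K₁^p ( (k/n) Σ_{j=1}^n ‖v_j‖_X^p + ((k/n)^{p/2}/2^n) Σ_{ε∈{−1,1}^n} ‖Σ_{j=1}^n ε_j v_j‖_X^p ); and (ii) the dimension-free vector-valued Riesz transform inequality holds: there are K₂, K₃ ∈ (0, ∞) such that for all n ∈ ℕ and all h : {−1,1}^n → X, K₂^{−p} ‖(Δ_{[n]}^{1/2} ⊗ I_X) h‖_{L_p(X)}^p ≤ 2^{−n} Σ_{δ∈{−1,1}^n} ‖Σ_{j=1}^n δ_j (∂_j ⊗ I_X) h‖_{L_p(X)}^p ≤ K₃^p ‖(Δ_{[n]}^{1/2} ⊗ I_X) h‖_{L_p(X)}^p. Then there exists C ∈ (0, ∞) (depending on p, K₁, K₂, K₃ and X) such that for all k, m, n ∈ ℕ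 with k ≤ n and m ≥ √(n/k), every f : ℤ_{8m}^n → X satisfies ( (1/binom(n,k)) Σ_{S⊆[n],|S|=k} E[ ‖f(x + 4m·ε_S) − f(x)‖_X^p ] )^{1/p} ≤ C·m·( (k/n) Σ_{j=1}^n E[ ‖f(x + e_j) − f(x)‖_X^p ] + (k/n)^{p/2} E[ ‖f(x + ε) − f(x)‖_X^p ] )^{1/p}, where the expectations are over (x, ε) uniform on ℤ_{8m}^n × {−1,1}^n. -/

import Mathlib

open Finset

/-- The `L_p(X)` norm (normalized counting measure) of an `X`-valued function on the
discrete hypercube `{-1,1}^n` (coordinates encoded by `Bool`). -/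
noncomputable def lpXnorm {n : ℕ} (p : ℝ) {X : Type*} [NormedAddCommGroup X]
    (h : (Fin n → Bool) → X) : ℝ :=
  ((∑ ε : Fin n → Bool, ‖h ε‖ ^ p) / 2 ^ n) ^ (1 / p)

/-- The Walsh function `W_A(ε) = Π_{j ∈ A} ε_j`. -/
def walsh {n : ℕ} (A : Finset (Fin n)) (ε : Fin n → Bool) : ℝ :=
  ∏ j ∈ A, (if ε j then (1 : ℝ) else -1)

/-- The `X`-valued Fourier–Walsh coefficient `ĥ(A) = 2^{-n} Σ_ε W_A(ε) h(ε)`. -/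
noncomputable def fourierX {n : ℕ} {X : Type*} [NormedAddCommGroup X] [NormedSpace ℝ X]
    (h : (Fin n → Bool) → X) (A : Finset (Fin n)) : X :=
  ((2 : ℝ) ^ n)⁻¹ • ∑ ε : Fin n → Bool, walsh A ε • h ε

/-- The vector-valued hypercube partial derivative `(∂_j ⊗ I_X) h`. -/
noncomputable def dflipX {n : ℕ} {X : Type*} [NormedAddCommGroup X] (j : Fin n)
    (h : (Fin n → Bool) → X) : (Fin n → Bool) → X :=
  fun ε => h ε - h (Function.update ε j (!ε j))

/-- The vector-valued fractional Laplacian `(Δ_{[n]}^α ⊗ I_X) h = Σ_{A ≠ ∅} |A|^α W_A ĥ(A)`. -/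
noncomputable def deltaPowX {n : ℕ} {X : Type*} [NormedAddCommGroup X] [NormedSpace ℝ X]
    (α : ℝ) (h : (Fin n → Bool) → X) : (Fin n → Bool) → X :=
  fun ε => ∑ A : Finset (Fin n),
    if A.Nonempty then (((A.card : ℝ) ^ α) * walsh A ε) • fourierX h A else 0

/-! ### Convexity of the `p`-th power of the norm -/

section Convexity

variable {X : Type*} [NormedAddCommGroup X] [NormedSpace ℝ X] {p : ℝ}

theorem norm_sum_smul_rpow_le (hp : 1 ≤ p) {ι : Type*} (s : Finset ι) (w : ι → ℝ) (g : ι → X)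
    (hw : ∀ i ∈ s, 0 ≤ w i) (hw1 : ∑ i ∈ s, w i = 1) :
    ‖∑ i ∈ s, w i • g i‖ ^ p ≤ ∑ i ∈ s, w i * ‖g i‖ ^ p := by
  refine le_trans ?_ (Real.rpow_arith_mean_le_arith_mean_rpow s w (fun i => ‖g i‖) hw hw1
    (fun i _ => norm_nonneg _) hp)
  refine Real.rpow_le_rpow (norm_nonneg _) ((norm_sum_le _ _).trans_eq ?_) (by linarith)
  refine sum_congr rfl fun i hi => ?_
  rw [norm_smul, Real.norm_of_nonneg (hw i hi)]

theorem norm_sum_rpow_le (hp : 1 ≤ p) {ι : Type*} (s : Finset ι) (g : ι → X) :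
    ‖∑ i ∈ s, g i‖ ^ p ≤ (s.card : ℝ) ^ (p - 1) * ∑ i ∈ s, ‖g i‖ ^ p := by
  rcases s.eq_empty_or_nonempty with rfl | hs
  · simp [Real.zero_rpow (by linarith : p ≠ 0)]
  have hc : (0 : ℝ) < s.card := by exact_mod_cast hs.card_pos
  have h := norm_sum_smul_rpow_le hp s (fun _ => (s.card : ℝ)⁻¹) g (fun _ _ => by positivity)
    (by rw [sum_const, nsmul_eq_mul, mul_inv_cancel₀ hc.ne'])
  rw [← smul_sum, norm_smul, ← mul_sum, Real.norm_of_nonneg (by positivity),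
    Real.mul_rpow (by positivity) (norm_nonneg _), Real.inv_rpow hc.le] at h
  have hcp : (0 : ℝ) < (s.card : ℝ) ^ p := Real.rpow_pos_of_pos hc _
  rw [Real.rpow_sub_one hc.ne']
  calc ‖∑ i ∈ s, g i‖ ^ p = (s.card : ℝ) ^ p * (((s.card : ℝ) ^ p)⁻¹ * ‖∑ i ∈ s, g i‖ ^ p) := by
        field_simp
    _ ≤ (s.card : ℝ) ^ p * ((s.card : ℝ)⁻¹ * ∑ i ∈ s, ‖g i‖ ^ p) := by gcongr
    _ = _ := by ring

theorem norm_sub_rpow_le (hp : 1 ≤ p) (a b : X) :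
    ‖a - b‖ ^ p ≤ 2 ^ (p - 1) * (‖a‖ ^ p + ‖b‖ ^ p) := by
  have h := norm_sum_rpow_le hp univ ![a, -b]
  simpa [Fin.sum_univ_two, sub_eq_add_neg] using h

theorem norm_cube_average_rpow_le (hp : 1 ≤ p) {n : ℕ} (g : (Fin n → Bool) → X) :
    ‖((2 : ℝ) ^ n)⁻¹ • ∑ δ, g δ‖ ^ p ≤ ((2 : ℝ) ^ n)⁻¹ * ∑ δ, ‖g δ‖ ^ p := by
  rw [smul_sum, mul_sum]
  exact norm_sum_smul_rpow_le hp univ _ g (fun _ _ => by positivity) (by simp)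

/-- A doubly stochastic kernel is an `L_p(X)` contraction. -/
theorem sum_norm_kernel_rpow_le (hp : 1 ≤ p) {ι : Type*} [Fintype ι] (K : ι → ι → ℝ)
    (hK : ∀ i j, 0 ≤ K i j) (hrow : ∀ i, ∑ j, K i j = 1) (hcol : ∀ j, ∑ i, K i j = 1)
    (g : ι → X) : ∑ i, ‖∑ j, K i j • g j‖ ^ p ≤ ∑ j, ‖g j‖ ^ p := by
  calc ∑ i, ‖∑ j, K i j • g j‖ ^ p ≤ ∑ i, ∑ j, K i j * ‖g j‖ ^ p :=
        sum_le_sum fun i _ => norm_sum_smul_rpow_le hp univ _ g (fun j _ => hK i j) (hrow i)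
    _ = ∑ j, ‖g j‖ ^ p := by
        rw [sum_comm]
        simp_rw [← sum_mul, hcol, one_mul]

end Convexity

/-! ### Walsh analysis on the discrete cube -/

section Walsh

variable {n : ℕ} {X : Type*} [NormedAddCommGroup X] [NormedSpace ℝ X]

theorem walsh_eq_prod_ite (A : Finset (Fin n)) (ε : Fin n → Bool) :
    walsh A ε = ∏ j, if j ∈ A then (if ε j then (1 : ℝ) else -1) else 1 := by
  rw [walsh, prod_ite_mem, univ_inter]

theorem sum_walsh (A : Finset (Fin n)) :
    ∑ ε : Fin n → Bool, walsh A ε = if A = ∅ then (2 : ℝ) ^ n else 0 := by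
  have h := prod_univ_sum (fun _ : Fin n => (univ : Finset Bool))
    (fun j b => if j ∈ A then (if b then (1 : ℝ) else -1) else 1)
  rw [Fintype.piFinset_univ] at h
  simp_rw [walsh_eq_prod_ite, ← h]
  split_ifs with hA
  · subst hA
    norm_num
  · obtain ⟨j, hj⟩ := nonempty_iff_ne_empty.mpr hA
    exact prod_eq_zero (mem_univ j) (by simp [hj])

theorem walsh_mul_walsh (A B : Finset (Fin n)) (ε : Fin n → Bool) :
    walsh A ε * walsh B ε = walsh (symmDiff A B) ε := by
  simp_rw [walsh_eq_prod_ite, ← prod_mul_distrib]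
  refine prod_congr rfl fun j _ => ?_
  by_cases hA : j ∈ A <;> by_cases hB : j ∈ B <;> cases ε j <;> simp [hA, hB, mem_symmDiff]

theorem sum_walsh_mul_walsh (A B : Finset (Fin n)) :
    ∑ ε : Fin n → Bool, walsh A ε * walsh B ε = if A = B then (2 : ℝ) ^ n else 0 := by
  simp_rw [walsh_mul_walsh, sum_walsh]
  congr 1
  simp [← bot_eq_empty]

theorem walsh_mul_walsh_apply (A : Finset (Fin n)) (ε η : Fin n → Bool) :
    walsh A ε * walsh A η = ∏ j ∈ A, (if ε j = η j then (1 : ℝ) else -1) := by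
  rw [walsh, walsh, ← prod_mul_distrib]
  refine prod_congr rfl fun j _ => ?_
  cases ε j <;> cases η j <;> simp

theorem sum_walsh_mul_walsh_apply (ε η : Fin n → Bool) :
    ∑ A : Finset (Fin n), walsh A ε * walsh A η = if ε = η then (2 : ℝ) ^ n else 0 := by
  simp_rw [walsh_mul_walsh_apply]
  rw [← powerset_univ, ← prod_one_add]
  split_ifs with h
  · subst h
    norm_num
  · obtain ⟨j, hj⟩ := Function.ne_iff.mp h
    exact prod_eq_zero (mem_univ j) (by simp [hj])

/-- The function on the cube with prescribed Walsh coefficients. -/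
noncomputable def walshSum (c : Finset (Fin n) → X) : (Fin n → Bool) → X :=
  fun ε => ∑ A : Finset (Fin n), walsh A ε • c A

theorem fourierX_walshSum (c : Finset (Fin n) → X) (A : Finset (Fin n)) :
    fourierX (walshSum c) A = c A := by
  simp_rw [fourierX, walshSum, smul_sum (s := (univ : Finset (Finset (Fin n)))), smul_smul]
  rw [sum_comm]
  simp_rw [← sum_smul, sum_walsh_mul_walsh]
  simp [ite_smul, smul_smul]

theorem walshSum_fourierX (h : (Fin n → Bool) → X) : walshSum (fourierX h) = h := by
  funext ε
  simp_rw [walshSum, fourierX, smul_sum, smul_smul]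
  rw [sum_comm]
  simp_rw [mul_left_comm _ ((2 : ℝ) ^ n)⁻¹, ← sum_smul, ← mul_sum, sum_walsh_mul_walsh_apply]
  simp [ite_smul]

theorem deltaPowX_eq_walshSum (α : ℝ) (h : (Fin n → Bool) → X) :
    deltaPowX α h = walshSum fun A =>
      if A.Nonempty then ((A.card : ℝ) ^ α) • fourierX h A else 0 := by
  funext ε
  refine sum_congr rfl fun A _ => ?_
  dsimp only
  split_ifs
  · rw [smul_smul, mul_comm]
  · rw [smul_zero]

theorem deltaPowX_half_deltaPowX_neg_half (h : (Fin n → Bool) → X) (hh : ∑ ε, h ε = 0) :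
    deltaPowX (1 / 2) (deltaPowX (-(1 / 2)) h) = h := by
  rw [deltaPowX_eq_walshSum, deltaPowX_eq_walshSum (-(1 / 2))]
  conv_rhs => rw [← walshSum_fourierX h]
  congr 1
  funext A
  rw [fourierX_walshSum]
  split_ifs with hA
  · have : (0 : ℝ) < A.card := by exact_mod_cast hA.card_pos
    rw [smul_smul, ← Real.rpow_add this]
    simp
  · rw [not_nonempty_iff_eq_empty] at hA
    subst hA
    simp [fourierX, walsh, hh]

theorem walsh_update_not (A : Finset (Fin n)) (ε : Fin n → Bool) (j : Fin n) :
    walsh A (Function.update ε j (!ε j)) = (if j ∈ A then -1 else 1) * walsh A ε := by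
  have h : (if j ∈ A then (-1 : ℝ) else 1) =
      ∏ i, if i = j then (if j ∈ A then (-1 : ℝ) else 1) else 1 := by simp
  rw [h, walsh_eq_prod_ite, walsh_eq_prod_ite, ← prod_mul_distrib]
  refine prod_congr rfl fun i _ => ?_
  by_cases hi : i = j
  · subst hi
    cases ε i <;> by_cases hA : i ∈ A <;> simp [hA]
  · simp [hi]

theorem dflipX_walshSum (j : Fin n) (c : Finset (Fin n) → X) :
    dflipX j (walshSum c) = walshSum fun A => if j ∈ A then (2 : ℝ) • c A else 0 := by
  funext ε
  simp_rw [dflipX, walshSum, ← sum_sub_distrib, ← sub_smul, walsh_update_not]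
  refine sum_congr rfl fun A _ => ?_
  split_ifs with hj
  · rw [smul_smul]
    congr 1
    ring
  · simp

end Walsh

/-! ### Averaging over the coordinates outside a set -/

section Average

variable {n : ℕ} {X : Type*} [NormedAddCommGroup X] [NormedSpace ℝ X]

/-- The point of the cube agreeing with `ε` on `S` and with `δ` off `S`. -/
def cubeMix (S : Finset (Fin n)) (ε δ : Fin n → Bool) : Fin n → Bool :=
  fun j => if j ∈ S then ε j else δ j

theorem sum_sum_cubeMix {M : Type*} [AddCommMonoid M] (S : Finset (Fin n))
    (F : (Fin n → Bool) → M) :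
    ∑ ε, ∑ δ, F (cubeMix S ε δ) = (2 ^ n) • ∑ ε, F ε := by
  have hinv : Function.Involutive fun q : (Fin n → Bool) × (Fin n → Bool) =>
      (cubeMix S q.1 q.2, cubeMix S q.2 q.1) := by
    rintro ⟨a, b⟩
    refine Prod.ext ?_ ?_ <;> funext j <;> by_cases hj : j ∈ S <;> simp [cubeMix, hj]
  rw [← Fintype.sum_prod_type' fun ε δ => F (cubeMix S ε δ),
    Fintype.sum_bijective _ hinv.bijective _ (fun q => F q.1) (fun _ => rfl),
    Fintype.sum_prod_type]
  simp [sum_nsmul]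

theorem sum_cube_not {M : Type*} [AddCommMonoid M] (F : (Fin n → Bool) → M) :
    ∑ ε : Fin n → Bool, F (fun j => !ε j) = ∑ ε, F ε := by
  have hinv : Function.Involutive fun ε : Fin n → Bool => fun j => !ε j := fun ε => by simp
  exact Fintype.sum_bijective _ hinv.bijective _ _ fun _ => rfl

/-- The average of `h` over the coordinates outside `S`. -/
noncomputable def cubeAverage (S : Finset (Fin n)) (h : (Fin n → Bool) → X) :
    (Fin n → Bool) → X :=
  fun ε => ((2 : ℝ) ^ n)⁻¹ • ∑ δ, h (cubeMix S ε δ)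

theorem sum_norm_cubeAverage_rpow_le {p : ℝ} (hp : 1 ≤ p) (S : Finset (Fin n))
    (h : (Fin n → Bool) → X) : ∑ ε, ‖cubeAverage S h ε‖ ^ p ≤ ∑ ε, ‖h ε‖ ^ p := by
  calc ∑ ε, ‖cubeAverage S h ε‖ ^ p
      ≤ ∑ ε, ((2 : ℝ) ^ n)⁻¹ * ∑ δ, ‖h (cubeMix S ε δ)‖ ^ p :=
        sum_le_sum fun ε _ => norm_cube_average_rpow_le hp _
    _ = ∑ ε, ‖h ε‖ ^ p := by
        rw [← mul_sum, sum_sum_cubeMix S fun ε => ‖h ε‖ ^ p]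
        simp [nsmul_eq_mul]

theorem cubeAverage_walshSum (S : Finset (Fin n)) (c : Finset (Fin n) → X) :
    cubeAverage S (walshSum c) = walshSum fun A => if A ⊆ S then c A else 0 := by
  funext ε
  simp_rw [cubeAverage, walshSum]
  rw [sum_comm, smul_sum]
  refine sum_congr rfl fun A _ => ?_
  have hmix : ∀ δ, walsh A (cubeMix S ε δ) = walsh (A ∩ S) ε * walsh (A \ S) δ := by
    intro δ
    simp_rw [walsh_eq_prod_ite, ← prod_mul_distrib]
    refine prod_congr rfl fun j _ => ?_
    by_cases hA : j ∈ A <;> by_cases hS : j ∈ S <;> simp [hA, hS, cubeMix]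
  simp_rw [hmix, ← sum_smul, ← mul_sum, sum_walsh, sdiff_eq_empty_iff_subset]
  split_ifs with hS
  · rw [smul_smul, inter_eq_left.mpr hS]
    congr 1
    field_simp
  · simp

theorem deltaPowX_cubeAverage (α : ℝ) (S : Finset (Fin n)) (h : (Fin n → Bool) → X) :
    deltaPowX α (cubeAverage S h) = cubeAverage S (deltaPowX α h) := by
  rw [deltaPowX_eq_walshSum α h, cubeAverage_walshSum, ← walshSum_fourierX h,
    cubeAverage_walshSum, deltaPowX_eq_walshSum]
  simp_rw [fourierX_walshSum]
  congr 1
  funext A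
  split_ifs <;> simp

theorem sum_smul_dflipX_cubeAverage (S : Finset (Fin n)) (h : (Fin n → Bool) → X)
    (w : Fin n → ℝ) (ε : Fin n → Bool) :
    ∑ j, w j • dflipX j (cubeAverage S h) ε =
      cubeAverage S (fun ε => ∑ j ∈ S, w j • dflipX j h ε) ε := by
  rw [cubeAverage, sum_comm, smul_sum, ← sum_subset (subset_univ S)]
  · refine sum_congr rfl fun j hj => ?_
    rw [← smul_sum, smul_comm]
    congr 1
    simp_rw [dflipX, cubeAverage, sum_sub_distrib, smul_sub]
    congr 3
    funext δ
    congr 1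
    funext i
    by_cases hi : i = j
    · subst hi
      simp [cubeMix, hj]
    · simp [cubeMix, hi]
  · intro j _ hj
    have : cubeMix S (Function.update ε j (!ε j)) = cubeMix S ε := by
      funext δ i
      by_cases hi : i ∈ S
      · simp [cubeMix, hi, ne_of_mem_of_not_mem hi hj]
      · simp [cubeMix, hi]
    simp [dflipX, cubeAverage, this]

end Average

/-! ### Contractivity of the inverse square root of the Laplacian on derivatives -/

section InverseSqrt

variable {n : ℕ} {X : Type*} [NormedAddCommGroup X] [NormedSpace ℝ X]

theorem integrableOn_rpow_mul_exp_neg_mul {r : ℝ} (hr : 0 < r) :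
    MeasureTheory.IntegrableOn (fun t : ℝ => t ^ ((1 : ℝ) / 2 - 1) * Real.exp (-(r * t)))
      (Set.Ioi 0) := by
  by_contra h
  have h1 := Real.integral_rpow_mul_exp_neg_mul_Ioi (a := 1 / 2) (by norm_num) hr
  rw [MeasureTheory.integral_undef h] at h1
  have h2 : 0 < (1 / r) ^ ((1 : ℝ) / 2) * Real.Gamma (1 / 2) :=
    mul_pos (Real.rpow_pos_of_pos (by positivity) _) (Real.Gamma_pos_of_pos (by norm_num))
  linarith

/-- Positivity of the Riesz-type product kernel whose Walsh coefficient at `A` is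
`(1 + |A \ {j}|)^{-1/2}`. -/
theorem sum_rpow_mul_prod_nonneg (j : Fin n) (s : Fin n → ℝ) (hs : ∀ i, |s i| ≤ 1) :
    0 ≤ ∑ A : Finset (Fin n), ((1 + (A.erase j).card : ℝ) ^ (-(1 / 2) : ℝ)) * ∏ i ∈ A, s i := by
  have hΓ : 0 < Real.Gamma (1 / 2) := Real.Gamma_pos_of_pos (by norm_num)
  refine nonneg_of_mul_nonneg_left ?_ hΓ
  rw [sum_mul]
  have hterm : ∀ A : Finset (Fin n),
      ((1 + (A.erase j).card : ℝ) ^ (-(1 / 2) : ℝ)) * (∏ i ∈ A, s i) * Real.Gamma (1 / 2) =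
      ∫ t in Set.Ioi (0 : ℝ), (∏ i ∈ A, s i) *
        (t ^ ((1 : ℝ) / 2 - 1) * Real.exp (-((1 + (A.erase j).card : ℝ) * t))) := by
    intro A
    rw [MeasureTheory.integral_const_mul, Real.integral_rpow_mul_exp_neg_mul_Ioi (by norm_num)
      (by positivity), Real.div_rpow zero_le_one (by positivity), Real.one_rpow,
      Real.rpow_neg (by positivity)]
    ring
  simp_rw [hterm]
  rw [← MeasureTheory.integral_finsetSum]
  swap
  · exact fun A _ => (integrableOn_rpow_mul_exp_neg_mul (by positivity)).const_mul _
  refine MeasureTheory.setIntegral_nonneg measurableSet_Ioi fun t ht => ?_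
  have ht : (0 : ℝ) < t := ht
  have hfac : ∑ A : Finset (Fin n), (∏ i ∈ A, s i) *
      (t ^ ((1 : ℝ) / 2 - 1) * Real.exp (-((1 + (A.erase j).card : ℝ) * t))) =
      t ^ ((1 : ℝ) / 2 - 1) * Real.exp (-t) *
        ∏ i, (1 + (if i = j then 1 else Real.exp (-t)) * s i) := by
    rw [prod_one_add, powerset_univ, mul_sum]
    refine sum_congr rfl fun A _ => ?_
    have hexp : Real.exp (-((1 + (A.erase j).card : ℝ) * t)) =
        Real.exp (-t) * ∏ i ∈ A, (if i = j then 1 else Real.exp (-t)) := by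
      rw [prod_ite, prod_const_one, one_mul, prod_const, filter_ne', ← Real.exp_nat_mul,
        ← Real.exp_add]
      congr 1
      ring
    rw [hexp, prod_mul_distrib]
    ring
  rw [hfac]
  refine mul_nonneg (by positivity) (prod_nonneg fun i _ => ?_)
  have h1 : |(if i = j then 1 else Real.exp (-t)) * s i| ≤ 1 := by
    rw [abs_mul]
    refine mul_le_one₀ ?_ (abs_nonneg _) (hs i)
    split_ifs
    · simp
    · rw [Real.abs_exp, Real.exp_le_one_iff]
      linarith
  linarith [neg_abs_le ((if i = j then 1 else Real.exp (-t)) * s i)]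

theorem dflipX_deltaPowX_neg_half (j : Fin n) (h : (Fin n → Bool) → X) (ε : Fin n → Bool) :
    dflipX j (deltaPowX (-(1 / 2)) h) ε = ∑ η, (((2 : ℝ) ^ n)⁻¹ * ∑ A : Finset (Fin n),
      ((1 + (A.erase j).card : ℝ) ^ (-(1 / 2) : ℝ)) * (walsh A ε * walsh A η)) •
        dflipX j h η := by
  have h1 : dflipX j (deltaPowX (-(1 / 2)) h) ε = ∑ A : Finset (Fin n),
      walsh A ε • ((1 + (A.erase j).card : ℝ) ^ (-(1 / 2) : ℝ)) •
        fourierX (dflipX j h) A := by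
    conv_rhs => rw [← walshSum_fourierX h, dflipX_walshSum]
    rw [deltaPowX_eq_walshSum, dflipX_walshSum]
    refine sum_congr rfl fun A _ => ?_
    rw [fourierX_walshSum]
    dsimp only
    split_ifs with hj hA
    · rw [smul_comm (2 : ℝ)]
      congr 3
      rw [← card_erase_add_one hj]
      push_cast
      ring
    · exact absurd ⟨j, hj⟩ hA
    · simp
  rw [h1]
  simp_rw [fourierX, smul_sum, mul_sum, sum_smul, smul_smul]
  rw [sum_comm]
  refine sum_congr rfl fun η _ => sum_congr rfl fun A _ => ?_
  congr 1
  ring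

theorem sum_norm_dflipX_deltaPowX_neg_half_le {p : ℝ} (hp : 1 ≤ p) (j : Fin n)
    (h : (Fin n → Bool) → X) :
    ∑ ε, ‖dflipX j (deltaPowX (-(1 / 2)) h) ε‖ ^ p ≤ ∑ ε, ‖dflipX j h ε‖ ^ p := by
  simp_rw [dflipX_deltaPowX_neg_half]
  have hrow : ∀ ε : Fin n → Bool, ∑ η, (((2 : ℝ) ^ n)⁻¹ * ∑ A : Finset (Fin n),
      ((1 + (A.erase j).card : ℝ) ^ (-(1 / 2) : ℝ)) * (walsh A ε * walsh A η)) = 1 := by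
    intro ε
    rw [← mul_sum, sum_comm]
    simp_rw [← mul_sum, sum_walsh]
    simp [walsh]
  refine sum_norm_kernel_rpow_le hp _ (fun ε η => mul_nonneg (by positivity) ?_) hrow
    (fun η => ?_) _
  · simp_rw [walsh_mul_walsh_apply]
    refine sum_rpow_mul_prod_nonneg j _ fun i => ?_
    split_ifs <;> simp
  · simp_rw [mul_comm (walsh _ _) (walsh _ η)]
    exact hrow η

end InverseSqrt

section CubeInequality

variable {n : ℕ} {X : Type*} [NormedAddCommGroup X]

theorem lpXnorm_rpow {p : ℝ} (hp : 1 ≤ p) (h : (Fin n → Bool) → X) :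
    lpXnorm p h ^ p = (∑ ε, ‖h ε‖ ^ p) / 2 ^ n := by
  rw [lpXnorm, ← Real.rpow_mul (by positivity), one_div_mul_cancel (by linarith), Real.rpow_one]

variable [NormedSpace ℝ X]

/-- The `X_p` inequality for conditional expectations of mean-zero functions on the cube, given
the linear `X_p` inequality and the two-sided Riesz transform bounds on that cube. -/
theorem sum_cubeAverage_le {p : ℝ} (hp : 1 ≤ p) {K₁ K₂ K₃ : ℝ} (hK₁ : 0 < K₁) (hK₂ : 0 < K₂)
    {k : ℕ}
    (hXp : ∀ v : Fin n → X,
      (∑ S ∈ powersetCard k (univ : Finset (Fin n)), ∑ ε : Fin n → Bool,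
          ‖∑ j ∈ S, (if ε j then (1 : ℝ) else -1) • v j‖ ^ p) /
        (2 ^ n * (n.choose k)) ≤
      K₁ ^ p * (((k : ℝ) / n) * ∑ j : Fin n, ‖v j‖ ^ p +
        ((k : ℝ) / n) ^ (p / 2) / 2 ^ n * ∑ ε : Fin n → Bool,
          ‖∑ j : Fin n, (if ε j then (1 : ℝ) else -1) • v j‖ ^ p))
    (hRiesz : ∀ h : (Fin n → Bool) → X,
      K₂ ^ (-p) * lpXnorm p (deltaPowX (1 / 2) h) ^ p ≤
        (∑ δ : Fin n → Bool, lpXnorm p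
            (fun ε => ∑ j : Fin n, (if δ j then (1 : ℝ) else -1) • dflipX j h ε) ^ p) /
          2 ^ n ∧
      (∑ δ : Fin n → Bool, lpXnorm p
            (fun ε => ∑ j : Fin n, (if δ j then (1 : ℝ) else -1) • dflipX j h ε) ^ p) /
          2 ^ n ≤
        K₃ ^ p * lpXnorm p (deltaPowX (1 / 2) h) ^ p)
    (h : (Fin n → Bool) → X) (hh : ∑ ε, h ε = 0) :
    (∑ S ∈ powersetCard k (univ : Finset (Fin n)), ∑ ε, ‖cubeAverage S h ε‖ ^ p) /
        n.choose k ≤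
      K₂ ^ p * K₁ ^ p * (((k : ℝ) / n) * ∑ j, ∑ ε, ‖dflipX j h ε‖ ^ p +
        ((k : ℝ) / n) ^ (p / 2) * (K₃ ^ p * ∑ ε, ‖h ε‖ ^ p)) := by
  set u := deltaPowX (-(1 / 2)) h with hu
  have hinv : deltaPowX (1 / 2) u = h := deltaPowX_half_deltaPowX_neg_half h hh
  have h2n : (0 : ℝ) < 2 ^ n := by positivity
  have hlower : ∀ S : Finset (Fin n), ∑ ε, ‖cubeAverage S h ε‖ ^ p ≤
      K₂ ^ p * ((∑ ε, ∑ δ : Fin n → Bool,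
        ‖∑ j ∈ S, (if δ j then (1 : ℝ) else -1) • dflipX j u ε‖ ^ p) / 2 ^ n) := by
    intro S
    have h1 := (hRiesz (cubeAverage S u)).1
    rw [deltaPowX_cubeAverage, hinv] at h1
    simp_rw [sum_smul_dflipX_cubeAverage, lpXnorm_rpow hp] at h1
    have h2 : (∑ δ : Fin n → Bool, (∑ ε, ‖cubeAverage S (fun ε => ∑ j ∈ S,
        (if δ j then (1 : ℝ) else -1) • dflipX j u ε) ε‖ ^ p) / 2 ^ n) / 2 ^ n ≤
        (∑ δ : Fin n → Bool, (∑ ε, ‖∑ j ∈ S,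
        (if δ j then (1 : ℝ) else -1) • dflipX j u ε‖ ^ p) / 2 ^ n) / 2 ^ n := by
      exact div_le_div_of_nonneg_right (sum_le_sum fun δ _ => div_le_div_of_nonneg_right
        (sum_norm_cubeAverage_rpow_le hp S _) h2n.le) h2n.le
    have h3 := h1.trans h2
    rw [← sum_div, sum_comm, ← mul_div_assoc,
      div_le_div_iff_of_pos_right h2n, Real.rpow_neg hK₂.le] at h3
    rwa [inv_mul_le_iff₀ (Real.rpow_pos_of_pos hK₂ _)] at h3
  have hupper : ∑ ε, ∑ δ : Fin n → Bool,
      ‖∑ j, (if δ j then (1 : ℝ) else -1) • dflipX j u ε‖ ^ p ≤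
        2 ^ n * (K₃ ^ p * ∑ ε, ‖h ε‖ ^ p) := by
    have h1 := (hRiesz u).2
    rw [hinv] at h1
    simp_rw [lpXnorm_rpow hp] at h1
    rw [← sum_div, sum_comm, ← mul_div_assoc, div_le_div_iff_of_pos_right h2n,
      div_le_iff₀ h2n] at h1
    linarith
  calc (∑ S ∈ powersetCard k (univ : Finset (Fin n)), ∑ ε, ‖cubeAverage S h ε‖ ^ p) /
        n.choose k
      ≤ (∑ S ∈ powersetCard k (univ : Finset (Fin n)), K₂ ^ p * ((∑ ε, ∑ δ : Fin n → Bool,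
        ‖∑ j ∈ S, (if δ j then (1 : ℝ) else -1) • dflipX j u ε‖ ^ p) / 2 ^ n)) /
          n.choose k := by
        gcongr with S
        exact hlower S
    _ = K₂ ^ p * ∑ ε, (∑ S ∈ powersetCard k (univ : Finset (Fin n)), ∑ δ : Fin n → Bool,
        ‖∑ j ∈ S, (if δ j then (1 : ℝ) else -1) • dflipX j u ε‖ ^ p) /
          (2 ^ n * n.choose k) := by
        rw [← mul_sum, ← sum_div, ← sum_div, mul_div_assoc, div_div, sum_comm]
    _ ≤ K₂ ^ p * ∑ ε, K₁ ^ p * (((k : ℝ) / n) * ∑ j : Fin n, ‖dflipX j u ε‖ ^ p +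
        ((k : ℝ) / n) ^ (p / 2) / 2 ^ n * ∑ δ : Fin n → Bool,
          ‖∑ j : Fin n, (if δ j then (1 : ℝ) else -1) • dflipX j u ε‖ ^ p) := by
        gcongr with ε
        exact hXp _
    _ = K₂ ^ p * K₁ ^ p * (((k : ℝ) / n) * ∑ j, ∑ ε, ‖dflipX j u ε‖ ^ p +
        ((k : ℝ) / n) ^ (p / 2) / 2 ^ n * ∑ ε, ∑ δ : Fin n → Bool,
          ‖∑ j : Fin n, (if δ j then (1 : ℝ) else -1) • dflipX j u ε‖ ^ p) := by
        rw [← mul_sum, sum_add_distrib, ← mul_sum, ← mul_sum, sum_comm (γ := Fin n), mul_assoc]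
    _ ≤ K₂ ^ p * K₁ ^ p * (((k : ℝ) / n) * ∑ j, ∑ ε, ‖dflipX j h ε‖ ^ p +
        ((k : ℝ) / n) ^ (p / 2) / 2 ^ n * (2 ^ n * (K₃ ^ p * ∑ ε, ‖h ε‖ ^ p))) := by
        refine mul_le_mul_of_nonneg_left (add_le_add ?_ ?_) (by positivity)
        · exact mul_le_mul_of_nonneg_left
            (sum_le_sum fun j _ => sum_norm_dflipX_deltaPowX_neg_half_le hp j h) (by positivity)
        · exact mul_le_mul_of_nonneg_left hupper (by positivity)
    _ = _ := by
        field_simp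

end CubeInequality

/-! ### Increments of functions on a finite abelian group -/

section Increments

variable {G : Type*} [AddCommGroup G] [Fintype G] {X : Type*} [NormedAddCommGroup X]
  {p : ℝ}

theorem sum_norm_shift_sub_shift_rpow (F : G → X) (a b : G) :
    ∑ x, ‖F (x + a) - F (x + b)‖ ^ p = ∑ x, ‖F (x + (a - b)) - F x‖ ^ p := by
  rw [← Equiv.sum_comp (Equiv.addRight b) fun x => ‖F (x + (a - b)) - F x‖ ^ p]
  refine sum_congr rfl fun x _ => ?_
  rw [Equiv.coe_addRight, add_add_sub_cancel]

theorem sum_norm_shift_neg_sub_rpow (F : G → X) (a : G) :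
    ∑ x, ‖F (x + -a) - F x‖ ^ p = ∑ x, ‖F (x + a) - F x‖ ^ p := by
  have h := sum_norm_shift_sub_shift_rpow (p := p) F 0 a
  simp_rw [zero_sub, add_zero] at h
  rw [← h]
  simp_rw [norm_sub_rev]

variable [NormedSpace ℝ X]

theorem sum_norm_shift_nsmul_sub_rpow_le (hp : 1 ≤ p) (F : G → X) (z : G) (N : ℕ) :
    ∑ x, ‖F (x + N • z) - F x‖ ^ p ≤ (N : ℝ) ^ p * ∑ x, ‖F (x + z) - F x‖ ^ p := by
  calc ∑ x, ‖F (x + N • z) - F x‖ ^ p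
      ≤ ∑ x, (N : ℝ) ^ (p - 1) *
          ∑ t ∈ range N, ‖F (x + (t + 1) • z) - F (x + t • z)‖ ^ p := by
        refine sum_le_sum fun x _ => ?_
        have h := norm_sum_rpow_le hp (range N) fun t => F (x + (t + 1) • z) - F (x + t • z)
        rw [sum_range_sub (fun t => F (x + t • z)), zero_smul, add_zero, card_range] at h
        exact h
    _ = (N : ℝ) ^ (p - 1) * (N * ∑ x, ‖F (x + z) - F x‖ ^ p) := by
        rw [← mul_sum, sum_comm]
        simp_rw [sum_norm_shift_sub_shift_rpow F, add_smul, one_smul, add_sub_cancel_left]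
        rw [sum_const, card_range, nsmul_eq_mul]
    _ = (N : ℝ) ^ p * ∑ x, ‖F (x + z) - F x‖ ^ p := by
        rw [← mul_assoc]
        congr 1
        rcases N.eq_zero_or_pos with rfl | hN
        · rw [Nat.cast_zero, mul_zero, Real.zero_rpow (by linarith)]
        · have : (0 : ℝ) < N := by exact_mod_cast hN
          rw [Real.rpow_sub_one this.ne', div_mul_cancel₀ _ this.ne']

end Increments

/-! ### Increments of functions on a product of rings along sign vectors -/

section SignVectors

variable {n : ℕ} {R : Type*} [CommRing R]

/-- The vector `∑_{j ∈ S} ε_j e_j` with coordinates in the ring `R`. -/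
def signVec (R : Type*) [CommRing R] {n : ℕ} (S : Finset (Fin n)) (ε : Fin n → Bool) :
    Fin n → R :=
  fun j => if j ∈ S then (if ε j then 1 else -1) else 0

theorem signVec_not (S : Finset (Fin n)) (ε : Fin n → Bool) :
    signVec R S (fun j => !ε j) = -signVec R S ε := by
  funext j
  by_cases hS : j ∈ S <;> cases h : ε j <;> simp [signVec, hS, h]

theorem signVec_cubeMix (S : Finset (Fin n)) (ε δ : Fin n → Bool) :
    signVec R univ (cubeMix S ε δ) = signVec R S ε + signVec R Sᶜ δ := by
  funext j
  by_cases hS : j ∈ S <;> simp [signVec, cubeMix, hS]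

theorem signVec_update_not (ε : Fin n → Bool) (j : Fin n) :
    signVec R univ ε - signVec R univ (Function.update ε j (!ε j)) =
        2 • (fun i => if i = j then (1 : R) else 0) ∨
      signVec R univ ε - signVec R univ (Function.update ε j (!ε j)) =
        -(2 • (fun i => if i = j then (1 : R) else 0)) := by
  cases h : ε j
  · right
    funext i
    by_cases hi : i = j
    · subst hi
      simp [signVec, h]
      ring
    · simp [signVec, hi]
  · left
    funext i
    by_cases hi : i = j
    · subst hi
      simp [signVec, h]
      ring
    · simp [signVec, hi]

variable {X : Type*} [NormedAddCommGroup X]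

/-- The symmetric difference `ε ↦ f(x + ε) - f(x - ε)` of `f` at `x`. -/
def symmIncrement (f : (Fin n → R) → X) (x : Fin n → R) : (Fin n → Bool) → X :=
  fun ε => f (x + signVec R univ ε) - f (x - signVec R univ ε)

theorem sum_symmIncrement (f : (Fin n → R) → X) (x : Fin n → R) :
    ∑ ε, symmIncrement f x ε = 0 := by
  simp_rw [symmIncrement, sum_sub_distrib]
  rw [← sum_cube_not fun ε => f (x - signVec R univ ε)]
  simp_rw [signVec_not, sub_neg_eq_add, sub_self]

variable [NormedSpace ℝ X]

/-- The average of `f` over the neighbours `x + δ` of `x`, where `δ` is a full sign vector. -/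
noncomputable def signAverage (f : (Fin n → R) → X) (x : Fin n → R) : X :=
  ((2 : ℝ) ^ n)⁻¹ • ∑ δ, f (x + signVec R univ δ)

/-- The average of `f` over the points `x + δ` with `δ` a sign vector supported off `S`. -/
noncomputable def signAverageOff (S : Finset (Fin n)) (f : (Fin n → R) → X)
    (x : Fin n → R) : X :=
  ((2 : ℝ) ^ n)⁻¹ • ∑ δ, f (x + signVec R Sᶜ δ)

theorem signAverage_eq (S : Finset (Fin n)) (f : (Fin n → R) → X) (x : Fin n → R) :
    signAverage f x = ((2 : ℝ) ^ n)⁻¹ • ∑ θ, signAverageOff S f (x + signVec R S θ) := by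
  simp_rw [signAverageOff, ← smul_sum, add_assoc, ← signVec_cubeMix]
  rw [sum_sum_cubeMix S fun δ => f (x + signVec R univ δ), ← Nat.cast_smul_eq_nsmul ℝ,
    signAverage, Nat.cast_pow, Nat.cast_ofNat, inv_smul_smul₀ (by positivity)]

theorem cubeAverage_symmIncrement (S : Finset (Fin n)) (f : (Fin n → R) → X) (x : Fin n → R)
    (ε : Fin n → Bool) :
    cubeAverage S (symmIncrement f x) ε =
      signAverageOff S f (x + signVec R S ε) - signAverageOff S f (x + -signVec R S ε) := by
  simp_rw [cubeAverage, symmIncrement, sum_sub_distrib, smul_sub, signAverageOff,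
    signVec_cubeMix]
  rw [← sum_cube_not fun δ => f (x + -signVec R S ε + signVec R Sᶜ δ)]
  simp_rw [signVec_not, add_assoc, sub_eq_add_neg, neg_add]

variable [Fintype R] {p : ℝ}

theorem sum_norm_symmIncrement_rpow_le (hp : 1 ≤ p) (f : (Fin n → R) → X) :
    ∑ x, ∑ ε, ‖symmIncrement f x ε‖ ^ p ≤
      2 ^ p * ∑ x, ∑ ε, ‖f (x + signVec R univ ε) - f x‖ ^ p := by
  rw [sum_comm, sum_comm (f := fun x ε => ‖f (x + signVec R univ ε) - f x‖ ^ p), mul_sum]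
  refine sum_le_sum fun ε _ => ?_
  simp_rw [symmIncrement, sub_eq_add_neg _ (signVec R univ ε)]
  rw [sum_norm_shift_sub_shift_rpow, sub_neg_eq_add, ← two_nsmul]
  exact_mod_cast sum_norm_shift_nsmul_sub_rpow_le hp f (signVec R univ ε) 2

theorem sum_norm_dflipX_symmIncrement_rpow_le (hp : 1 ≤ p) (f : (Fin n → R) → X) (j : Fin n) :
    ∑ x, ∑ ε, ‖dflipX j (symmIncrement f x) ε‖ ^ p ≤
      4 ^ p * (2 ^ n * ∑ x, ‖f (x + fun i => if i = j then 1 else 0) - f x‖ ^ p) := by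
  rw [sum_comm]
  set E := ∑ x, ‖f (x + fun i => if i = j then 1 else 0) - f x‖ ^ p
  have hstep : ∀ a b : Fin n → R,
      (a - b = 2 • (fun i => if i = j then (1 : R) else 0) ∨
        a - b = -(2 • (fun i => if i = j then (1 : R) else 0))) →
      ∑ x, ‖f (x + a) - f (x + b)‖ ^ p ≤ 2 ^ p * E := by
    intro a b hab
    rw [sum_norm_shift_sub_shift_rpow]
    have h2 := sum_norm_shift_nsmul_sub_rpow_le hp f (fun i => if i = j then (1 : R) else 0) 2
    rw [Nat.cast_ofNat] at h2
    rcases hab with h | h <;> rw [h]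
    · exact h2
    · rw [sum_norm_shift_neg_sub_rpow]
      exact h2
  have hε : ∀ ε : Fin n → Bool,
      ∑ x, ‖dflipX j (symmIncrement f x) ε‖ ^ p ≤ 4 ^ p * E := by
    intro ε
    set a := signVec R univ ε
    set b := signVec R univ (Function.update ε j (!ε j))
    have hab := signVec_update_not (R := R) ε j
    calc ∑ x, ‖dflipX j (symmIncrement f x) ε‖ ^ p
        ≤ ∑ x, 2 ^ (p - 1) * (‖f (x + a) - f (x + b)‖ ^ p +
            ‖f (x + -a) - f (x + -b)‖ ^ p) := by
          refine sum_le_sum fun x _ => ?_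
          have heq : dflipX j (symmIncrement f x) ε =
              (f (x + a) - f (x + b)) - (f (x + -a) - f (x + -b)) := by
            simp only [dflipX, symmIncrement, ← sub_eq_add_neg]
            abel
          rw [heq]
          exact norm_sub_rpow_le hp _ _
      _ ≤ 2 ^ (p - 1) * (2 ^ p * E + 2 ^ p * E) := by
          rw [← mul_sum, sum_add_distrib]
          refine mul_le_mul_of_nonneg_left (add_le_add (hstep _ _ hab) (hstep _ _ ?_))
            (by positivity)
          rw [neg_sub_neg, ← neg_sub, neg_eq_iff_eq_neg, neg_inj]
          exact hab.symm
      _ = 4 ^ p * E := by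
          rw [show (4 : ℝ) = 2 * 2 by norm_num, Real.mul_rpow (by norm_num) (by norm_num),
            Real.rpow_sub_one (by norm_num)]
          ring
  calc ∑ ε, ∑ x, ‖dflipX j (symmIncrement f x) ε‖ ^ p
      ≤ ∑ _ε : Fin n → Bool, 4 ^ p * E := sum_le_sum fun ε _ => hε ε
    _ = 4 ^ p * (2 ^ n * E) := by
        simp
        ring

theorem sum_norm_signAverage_sub_rpow_le (hp : 1 ≤ p) (f : (Fin n → R) → X) :
    ∑ x, ‖signAverage f x - f x‖ ^ p ≤
      ((2 : ℝ) ^ n)⁻¹ * ∑ x, ∑ δ, ‖f (x + signVec R univ δ) - f x‖ ^ p := by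
  rw [mul_sum]
  refine sum_le_sum fun x _ => ?_
  have h : signAverage f x - f x =
      ((2 : ℝ) ^ n)⁻¹ • ∑ δ, (f (x + signVec R univ δ) - f x) := by
    rw [sum_sub_distrib, smul_sub, signAverage]
    congr 1
    simp [← Nat.cast_smul_eq_nsmul ℝ]
  rw [h]
  exact norm_cube_average_rpow_le hp _

theorem sum_norm_signAverage_shift_sub_rpow_le (hp : 1 ≤ p) (S : Finset (Fin n))
    (f : (Fin n → R) → X) (ε : Fin n → Bool) :
    ∑ x, ‖signAverage f (x + 2 • signVec R S ε) - signAverage f x‖ ^ p ≤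
      ∑ x, ‖cubeAverage S (symmIncrement f x) ε‖ ^ p := by
  simp_rw [cubeAverage_symmIncrement, sum_norm_shift_sub_shift_rpow, sub_neg_eq_add,
    ← two_nsmul, signAverage_eq S f, ← smul_sub, ← sum_sub_distrib]
  calc _ ≤ ∑ x, ((2 : ℝ) ^ n)⁻¹ * ∑ θ,
        ‖signAverageOff S f (x + 2 • signVec R S ε + signVec R S θ) -
          signAverageOff S f (x + signVec R S θ)‖ ^ p :=
        sum_le_sum fun x _ => norm_cube_average_rpow_le hp _
    _ = _ := by
        rw [← mul_sum, sum_comm]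
        simp_rw [add_assoc, sum_norm_shift_sub_shift_rpow, add_sub_cancel_right]
        simp

theorem sum_norm_shift_even_nsmul_sub_rpow_le (hp : 1 ≤ p) (S : Finset (Fin n))
    (f : (Fin n → R) → X) (N : ℕ) :
    ∑ x, ∑ ε, ‖f (x + N • (2 • signVec R S ε)) - f x‖ ^ p ≤
      3 ^ (p - 1) * (2 * ∑ x, ∑ ε, ‖f (x + signVec R univ ε) - f x‖ ^ p +
        (N : ℝ) ^ p * ∑ x, ∑ ε, ‖cubeAverage S (symmIncrement f x) ε‖ ^ p) := by
  set D := ∑ x, ∑ ε, ‖f (x + signVec R univ ε) - f x‖ ^ p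
  have hB := sum_norm_signAverage_sub_rpow_le hp f
  have hε : ∀ ε : Fin n → Bool, ∑ x, ‖f (x + N • (2 • signVec R S ε)) - f x‖ ^ p ≤
      3 ^ (p - 1) * (2 * (((2 : ℝ) ^ n)⁻¹ * D) +
        (N : ℝ) ^ p * ∑ x, ‖cubeAverage S (symmIncrement f x) ε‖ ^ p) := by
    intro ε
    set y := N • (2 • signVec R S ε) with hy
    have hmid : ∑ x, ‖signAverage f (x + y) - signAverage f x‖ ^ p ≤
        (N : ℝ) ^ p * ∑ x, ‖cubeAverage S (symmIncrement f x) ε‖ ^ p :=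
      (sum_norm_shift_nsmul_sub_rpow_le hp _ _ N).trans
        (mul_le_mul_of_nonneg_left (sum_norm_signAverage_shift_sub_rpow_le hp S f ε)
          (by positivity))
    have hshift : ∑ x, ‖f (x + y) - signAverage f (x + y)‖ ^ p =
        ∑ x, ‖signAverage f x - f x‖ ^ p := by
      rw [← Equiv.sum_comp (Equiv.addRight y) fun x => ‖signAverage f x - f x‖ ^ p]
      simp_rw [Equiv.coe_addRight, norm_sub_rev]
    calc ∑ x, ‖f (x + y) - f x‖ ^ p
        ≤ ∑ x, 3 ^ (p - 1) * (‖f (x + y) - signAverage f (x + y)‖ ^ p +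
            ‖signAverage f (x + y) - signAverage f x‖ ^ p +
            ‖signAverage f x - f x‖ ^ p) := by
          refine sum_le_sum fun x _ => ?_
          have h := norm_sum_rpow_le hp univ ![f (x + y) - signAverage f (x + y),
            signAverage f (x + y) - signAverage f x, signAverage f x - f x]
          simpa [Fin.sum_univ_three] using h
      _ ≤ _ := by
          rw [← mul_sum, sum_add_distrib, sum_add_distrib, hshift]
          refine mul_le_mul_of_nonneg_left ?_ (by positivity)
          linarith
  rw [sum_comm]
  refine (sum_le_sum fun ε _ => hε ε).trans_eq ?_
  rw [← mul_sum, sum_add_distrib, ← mul_sum _ _ ((N : ℝ) ^ p), sum_comm (γ := Fin n → R)]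
  simp only [sum_const, card_univ, Fintype.card_pi, Fintype.card_bool, prod_const,
    Fintype.card_fin, nsmul_eq_mul]
  push_cast
  field_simp

/-- The un-normalized metric `X_p` inequality for functions on `R^n` with `R` a finite ring, given
the linear `X_p` inequality and the two-sided Riesz transform bounds on the `n`-cube. -/
theorem sum_norm_shift_signVec_sub_rpow_le (hp : 1 ≤ p) {K₁ K₂ K₃ : ℝ} (hK₁ : 0 < K₁)
    (hK₂ : 0 < K₂) (hK₃ : 0 < K₃) {k m : ℕ} (hkn : k ≤ n)
    (hscale : 1 ≤ (m : ℝ) ^ p * ((k : ℝ) / n) ^ (p / 2))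
    (hXp : ∀ v : Fin n → X,
      (∑ S ∈ powersetCard k (univ : Finset (Fin n)), ∑ ε : Fin n → Bool,
          ‖∑ j ∈ S, (if ε j then (1 : ℝ) else -1) • v j‖ ^ p) /
        (2 ^ n * (n.choose k)) ≤
      K₁ ^ p * (((k : ℝ) / n) * ∑ j : Fin n, ‖v j‖ ^ p +
        ((k : ℝ) / n) ^ (p / 2) / 2 ^ n * ∑ ε : Fin n → Bool,
          ‖∑ j : Fin n, (if ε j then (1 : ℝ) else -1) • v j‖ ^ p))
    (hRiesz : ∀ h : (Fin n → Bool) → X,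
      K₂ ^ (-p) * lpXnorm p (deltaPowX (1 / 2) h) ^ p ≤
        (∑ δ : Fin n → Bool, lpXnorm p
            (fun ε => ∑ j : Fin n, (if δ j then (1 : ℝ) else -1) • dflipX j h ε) ^ p) /
          2 ^ n ∧
      (∑ δ : Fin n → Bool, lpXnorm p
            (fun ε => ∑ j : Fin n, (if δ j then (1 : ℝ) else -1) • dflipX j h ε) ^ p) /
          2 ^ n ≤
        K₃ ^ p * lpXnorm p (deltaPowX (1 / 2) h) ^ p)
    (f : (Fin n → R) → X) :
    (∑ S ∈ powersetCard k (univ : Finset (Fin n)), ∑ x, ∑ ε,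
      ‖f (x + (2 * m) • (2 • signVec R S ε)) - f x‖ ^ p) / n.choose k ≤
    3 ^ (p - 1) * (2 + 2 ^ p * (K₂ ^ p * K₁ ^ p * (4 ^ p + K₃ ^ p * 2 ^ p))) * (m : ℝ) ^ p *
      (2 ^ n * (((k : ℝ) / n) *
          ∑ j, ∑ x, ‖f (x + fun i => if i = j then 1 else 0) - f x‖ ^ p) +
        ((k : ℝ) / n) ^ (p / 2) * ∑ x, ∑ ε, ‖f (x + signVec R univ ε) - f x‖ ^ p) := by
  have hK₃p := Real.rpow_pos_of_pos hK₃ p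
  have hm' : (0 : ℝ) ≤ m := Nat.cast_nonneg m
  have hchoose : (0 : ℝ) < n.choose k := by exact_mod_cast Nat.choose_pos hkn
  set D := ∑ x, ∑ ε, ‖f (x + signVec R univ ε) - f x‖ ^ p
  set E : Fin n → ℝ := fun j => ∑ x, ‖f (x + fun i => if i = j then 1 else 0) - f x‖ ^ p
  set r : ℝ := (k : ℝ) / n
  have hr0 : 0 ≤ r := by positivity
  have hD0 : 0 ≤ D := by positivity
  have hE0 : 0 ≤ ∑ j, E j := by positivity
  have hcube : (∑ S ∈ powersetCard k (univ : Finset (Fin n)),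
      ∑ x, ∑ ε, ‖cubeAverage S (symmIncrement f x) ε‖ ^ p) / n.choose k ≤
      K₂ ^ p * K₁ ^ p * (4 ^ p + K₃ ^ p * 2 ^ p) * (2 ^ n * (r * ∑ j, E j) + r ^ (p / 2) * D) := by
    calc (∑ S ∈ powersetCard k (univ : Finset (Fin n)),
        ∑ x, ∑ ε, ‖cubeAverage S (symmIncrement f x) ε‖ ^ p) / n.choose k
        = ∑ x, (∑ S ∈ powersetCard k (univ : Finset (Fin n)),
            ∑ ε, ‖cubeAverage S (symmIncrement f x) ε‖ ^ p) / n.choose k := by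
          rw [sum_comm, sum_div]
      _ ≤ ∑ x, K₂ ^ p * K₁ ^ p * (r * ∑ j, ∑ ε, ‖dflipX j (symmIncrement f x) ε‖ ^ p +
            r ^ (p / 2) * (K₃ ^ p * ∑ ε, ‖symmIncrement f x ε‖ ^ p)) :=
          sum_le_sum fun x _ => sum_cubeAverage_le hp hK₁ hK₂ hXp hRiesz _
            (sum_symmIncrement f x)
      _ = K₂ ^ p * K₁ ^ p * (r * ∑ j, ∑ x, ∑ ε, ‖dflipX j (symmIncrement f x) ε‖ ^ p +
            r ^ (p / 2) * (K₃ ^ p * ∑ x, ∑ ε, ‖symmIncrement f x ε‖ ^ p)) := by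
          rw [← mul_sum, sum_add_distrib, ← mul_sum, ← mul_sum, ← mul_sum,
            sum_comm (γ := Fin n → R)]
      _ ≤ K₂ ^ p * K₁ ^ p * (r * ∑ j, 4 ^ p * (2 ^ n * E j) +
            r ^ (p / 2) * (K₃ ^ p * (2 ^ p * D))) := by
          refine mul_le_mul_of_nonneg_left (add_le_add ?_ ?_) (by positivity)
          · exact mul_le_mul_of_nonneg_left
              (sum_le_sum fun j _ => sum_norm_dflipX_symmIncrement_rpow_le hp f j) hr0
          · exact mul_le_mul_of_nonneg_left (mul_le_mul_of_nonneg_left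
              (sum_norm_symmIncrement_rpow_le hp f) hK₃p.le) (by positivity)
      _ ≤ _ := by
          rw [← mul_sum, ← mul_sum, mul_assoc (K₂ ^ p * K₁ ^ p)]
          refine mul_le_mul_of_nonneg_left ?_ (by positivity)
          have h1 : 0 ≤ K₃ ^ p * 2 ^ p * (2 ^ n * (r * ∑ j, E j)) := by positivity
          have h2 : 0 ≤ 4 ^ p * (r ^ (p / 2) * D) := by positivity
          linarith
  set T := 2 ^ n * (r * ∑ j, E j) + r ^ (p / 2) * D with hT
  have hDT : D ≤ (m : ℝ) ^ p * T := by
    have h1 : D ≤ (m : ℝ) ^ p * r ^ (p / 2) * D := le_mul_of_one_le_left hD0 hscale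
    have h2 : 0 ≤ (m : ℝ) ^ p * (2 ^ n * (r * ∑ j, E j)) := by positivity
    rw [hT, mul_add]
    linarith
  calc _ ≤ (∑ S ∈ powersetCard k (univ : Finset (Fin n)), 3 ^ (p - 1) * (2 * D +
        ((2 * m : ℕ) : ℝ) ^ p * ∑ x, ∑ ε, ‖cubeAverage S (symmIncrement f x) ε‖ ^ p)) /
          n.choose k :=
        div_le_div_of_nonneg_right (sum_le_sum fun S _ =>
          sum_norm_shift_even_nsmul_sub_rpow_le hp S f (2 * m)) hchoose.le
    _ = 3 ^ (p - 1) * (2 * D + 2 ^ p * (m : ℝ) ^ p *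
        ((∑ S ∈ powersetCard k (univ : Finset (Fin n)),
          ∑ x, ∑ ε, ‖cubeAverage S (symmIncrement f x) ε‖ ^ p) / n.choose k)) := by
        rw [Nat.cast_mul, Nat.cast_ofNat, Real.mul_rpow (by norm_num) hm', ← mul_sum,
          sum_add_distrib, ← mul_sum _ _ (2 ^ p * (m : ℝ) ^ p), sum_const, card_powersetCard,
          card_univ, Fintype.card_fin, nsmul_eq_mul]
        field_simp
    _ ≤ 3 ^ (p - 1) * (2 * ((m : ℝ) ^ p * T) + 2 ^ p * (m : ℝ) ^ p *
        (K₂ ^ p * K₁ ^ p * (4 ^ p + K₃ ^ p * 2 ^ p) * T)) := by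
        refine mul_le_mul_of_nonneg_left (add_le_add ?_ ?_) (by positivity)
        · linarith
        · exact mul_le_mul_of_nonneg_left hcube (by positivity)
    _ = 3 ^ (p - 1) * (2 + 2 ^ p * (K₂ ^ p * K₁ ^ p * (4 ^ p + K₃ ^ p * 2 ^ p))) *
        (m : ℝ) ^ p * T := by
        ring

end SignVectors

theorem one_le_rpow_mul_div_rpow {p : ℝ} (hp : 0 ≤ p) {k m n : ℕ} (hk : 0 < k) (hn : 0 < n)
    (hm : Real.sqrt ((n : ℝ) / k) ≤ m) : 1 ≤ (m : ℝ) ^ p * ((k : ℝ) / n) ^ (p / 2) := by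
  have hk' : (0 : ℝ) < k := by exact_mod_cast hk
  have hn' : (0 : ℝ) < n := by exact_mod_cast hn
  have h1 : (n : ℝ) / k ≤ (m : ℝ) ^ 2 := (Real.sqrt_le_left (by positivity)).mp hm
  have h2 : 1 ≤ (m : ℝ) ^ 2 * ((k : ℝ) / n) := by
    calc (1 : ℝ) = (n : ℝ) / k * ((k : ℝ) / n) := by field_simp
      _ ≤ _ := by gcongr
  have h3 := Real.one_le_rpow h2 (by linarith : 0 ≤ p / 2)
  rw [Real.mul_rpow (by positivity) (by positivity), ← Real.rpow_natCast,
    ← Real.rpow_mul (by positivity)] at h3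
  convert h3 using 3
  push_cast
  ring

/-- **Theorem 4.1**: if `p ∈ [2,∞)` and `X` is a Banach space which is an `X_p` Banach space
(constant `K₁`) and satisfies the dimension-free vector-valued discrete Riesz transform
inequalities (constants `K₂, K₃`), then `X` satisfies the metric `X_p` inequality with the
sharp scaling parameter: there is `C > 0` such that for all `k, m, n ∈ ℕ` with `k ≤ n` and
`m ≥ √(n/k)`, every `f : ℤ_{8m}^n → X` satisfies the sharp-scaling metric `X_p` inequality. -/
theorem xp_banach_with_riesz_is_xp_metric (p : ℝ) (hp : 2 ≤ p)
    {X : Type*} [NormedAddCommGroup X] [NormedSpace ℝ X] [CompleteSpace X]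
    (K₁ : ℝ) (hK₁ : 0 < K₁)
    (hXp : ∀ n : ℕ, ∀ k : ℕ, 1 ≤ k → k ≤ n → ∀ v : Fin n → X,
      (∑ S ∈ powersetCard k (univ : Finset (Fin n)), ∑ ε : Fin n → Bool,
          ‖∑ j ∈ S, (if ε j then (1 : ℝ) else -1) • v j‖ ^ p) /
        (2 ^ n * (n.choose k)) ≤
      K₁ ^ p * (((k : ℝ) / n) * ∑ j : Fin n, ‖v j‖ ^ p +
        ((k : ℝ) / n) ^ (p / 2) / 2 ^ n * ∑ ε : Fin n → Bool,
          ‖∑ j : Fin n, (if ε j then (1 : ℝ) else -1) • v j‖ ^ p))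
    (K₂ K₃ : ℝ) (hK₂ : 0 < K₂) (hK₃ : 0 < K₃)
    (hRiesz : ∀ n : ℕ, ∀ h : (Fin n → Bool) → X,
      K₂ ^ (-p) * lpXnorm p (deltaPowX (1 / 2) h) ^ p ≤
        (∑ δ : Fin n → Bool, lpXnorm p
            (fun ε => ∑ j : Fin n, (if δ j then (1 : ℝ) else -1) • dflipX j h ε) ^ p) /
          2 ^ n ∧
      (∑ δ : Fin n → Bool, lpXnorm p
            (fun ε => ∑ j : Fin n, (if δ j then (1 : ℝ) else -1) • dflipX j h ε) ^ p) /
          2 ^ n ≤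
        K₃ ^ p * lpXnorm p (deltaPowX (1 / 2) h) ^ p) :
    ∃ C : ℝ, 0 < C ∧ ∀ (k m n : ℕ) [NeZero (8 * m)], 1 ≤ k → k ≤ n →
      Real.sqrt ((n : ℝ) / k) ≤ m →
      ∀ f : (Fin n → ZMod (8 * m)) → X,
      ((∑ S ∈ powersetCard k (univ : Finset (Fin n)),
          (∑ x : Fin n → ZMod (8 * m), ∑ ε : Fin n → Bool,
            ‖f (x + fun j => if j ∈ S then
                4 * (m : ZMod (8 * m)) * (if ε j then 1 else -1) else 0) - f x‖ ^ p) /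
          (16 * m : ℝ) ^ n) / (n.choose k)) ^ (1 / p) ≤
      C * m * (((k : ℝ) / n) * ∑ j : Fin n,
            (∑ x : Fin n → ZMod (8 * m),
              ‖f (x + fun i => if i = j then (1 : ZMod (8 * m)) else 0) - f x‖ ^ p) /
            (8 * m : ℝ) ^ n +
          ((k : ℝ) / n) ^ (p / 2) * (∑ x : Fin n → ZMod (8 * m), ∑ ε : Fin n → Bool,
              ‖f (x + fun j => if ε j then (1 : ZMod (8 * m)) else -1) - f x‖ ^ p) /
            (16 * m : ℝ) ^ n) ^ (1 / p) := by
  have hp1 : 1 ≤ p := by linarith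
  set A : ℝ := 3 ^ (p - 1) * (2 + 2 ^ p * (K₂ ^ p * K₁ ^ p * (4 ^ p + K₃ ^ p * 2 ^ p))) with hA
  have hA0 : 0 < A := by positivity
  refine ⟨A ^ (1 / p), Real.rpow_pos_of_pos hA0 _, fun k m n _ hk hkn hm f => ?_⟩
  have hm0 : 0 < m := Nat.pos_of_ne_zero fun h => NeZero.ne (8 * m) (by rw [h, mul_zero])
  have hm' : (0 : ℝ) < m := by exact_mod_cast hm0
  have hscale := one_le_rpow_mul_div_rpow (by linarith : 0 ≤ p) hk (by omega) hm
  have hsign : ∀ (S : Finset (Fin n)) (ε : Fin n → Bool), (fun j => if j ∈ S then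
      4 * (m : ZMod (8 * m)) * (if ε j then 1 else -1) else 0) =
      (2 * m) • (2 • signVec (ZMod (8 * m)) S ε) := by
    intro S ε
    funext j
    by_cases hS : j ∈ S
    · simp only [Pi.smul_apply, signVec, hS, if_true]
      simp only [nsmul_eq_mul]
      push_cast
      ring
    · simp [signVec, hS]
  have hfull : ∀ ε : Fin n → Bool, (fun j => if ε j then (1 : ZMod (8 * m)) else -1) =
      signVec (ZMod (8 * m)) univ ε := by
    intro ε
    funext j
    simp [signVec]
  simp_rw [hsign, hfull]
  have hmain := sum_norm_shift_signVec_sub_rpow_le hp1 hK₁ hK₂ hK₃ hkn hscale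
    (hXp n k hk hkn) (hRiesz n) f
  rw [← hA] at hmain
  have hpow : (A ^ (1 / p) * m) ^ p = A * (m : ℝ) ^ p := by
    rw [Real.mul_rpow (by positivity) hm'.le, ← Real.rpow_mul hA0.le,
      one_div_mul_cancel (by linarith), Real.rpow_one]
  have hsplit : (16 * m : ℝ) ^ n = 2 ^ n * (8 * m) ^ n := by
    rw [← mul_pow]
    congr 1
    ring
  rw [← Real.rpow_le_rpow_iff (by positivity) (by positivity) (by linarith : 0 < p),
    Real.mul_rpow (by positivity) (by positivity), hpow, ← Real.rpow_mul (by positivity),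
    ← Real.rpow_mul (by positivity), one_div_mul_cancel (by linarith), Real.rpow_one,
    Real.rpow_one, ← sum_div, ← sum_div, div_right_comm, hsplit]
  refine (div_le_div_of_nonneg_right hmain (by positivity)).trans_eq ?_
  field_simp
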